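/- Let f : U → ℝ³ with unit normal ν be a frontal in adapted coordinates (u,v) around a singular point of the first kind at the origin, and suppose the singular curve consists of pure-frontal singular points, i.e. Ñ(u,0) = 0 for all u. Then there exist smooth maps φ : U → ℝ³ and Ñ₁ : U → ℝ with ν_v = v·φ and Ñ = v·Ñ₁ on U, and on {v ≠ 0} the Gaussian and mean curvature of f equal K = (L̃Ñ₁ − M̃²)/(ẼG̃ − F̃²) and H = (ẼÑ₁ − 2F̃M̃ + G̃L̃)/(2(ẼG̃ − F̃²)). In particular, K and H extend to smooth (hence locally bounded) functions on all of U. -/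

import Mathlib

noncomputable section

open Matrix Set
open scoped ContDiff

abbrev V3 : Type := Fin 3 → ℝ

/-- Partial derivative in the `u`-direction. -/
def Du {E : Type*} [NormedAddCommGroup E] [NormedSpace ℝ E] (g : ℝ × ℝ → E) (p : ℝ × ℝ) : E :=
  fderiv ℝ g p (1, 0)

/-- Partial derivative in the `v`-direction. -/
def Dv {E : Type*} [NormedAddCommGroup E] [NormedSpace ℝ E] (g : ℝ × ℝ → E) (p : ℝ × ℝ) : E :=
  fderiv ℝ g p (0, 1)

def det3 (a b c : V3) : ℝ := Matrix.det (Matrix.of ![a, b, c])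

def dot (x y : V3) : ℝ := x ⬝ᵥ y

def nrm (x : V3) : ℝ := Real.sqrt (dot x x)

def cross3 (x y : V3) : V3 := crossProduct x y

structure FrontalData where
  f : ℝ × ℝ → V3
  nu : ℝ × ℝ → V3
  h : ℝ × ℝ → V3

namespace FrontalData

def Et (X : FrontalData) (p : ℝ × ℝ) : ℝ := dot (Du X.f p) (Du X.f p)
def Ft (X : FrontalData) (p : ℝ × ℝ) : ℝ := dot (Du X.f p) (X.h p)
def Gt (X : FrontalData) (p : ℝ × ℝ) : ℝ := dot (X.h p) (X.h p)
def Lt (X : FrontalData) (p : ℝ × ℝ) : ℝ := -(dot (Du X.f p) (Du X.nu p))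
def Mt (X : FrontalData) (p : ℝ × ℝ) : ℝ := -(dot (X.h p) (Du X.nu p))
def Nt (X : FrontalData) (p : ℝ × ℝ) : ℝ := -(dot (X.h p) (Dv X.nu p))

def EGF (X : FrontalData) (p : ℝ × ℝ) : ℝ := X.Et p * X.Gt p - (X.Ft p) ^ 2

/-- `f` is a frontal with unit normal `nu`, in adapted coordinates around a singular point of
the first kind at the origin: `f_v = v • h` and `{f_u, h, nu}` is a frame. -/
def IsAdapted (X : FrontalData) (U : Set (ℝ × ℝ)) : Prop :=
  IsOpen U ∧ (0, 0) ∈ U ∧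
  ContDiff ℝ ∞ X.f ∧ ContDiff ℝ ∞ X.nu ∧ ContDiff ℝ ∞ X.h ∧
  (∀ p ∈ U, dot (X.nu p) (X.nu p) = 1) ∧
  (∀ p ∈ U, dot (Du X.f p) (X.nu p) = 0) ∧
  (∀ p ∈ U, dot (Dv X.f p) (X.nu p) = 0) ∧
  (∀ p ∈ U, Dv X.f p = p.2 • X.h p) ∧
  (∀ p ∈ U, det3 (Du X.f p) (X.h p) (X.nu p) ≠ 0) ∧
  (∀ p ∈ U, 0 < X.EGF p)

/-- orthogonal adapted coordinates -/
def IsOrthogonal (X : FrontalData) (U : Set (ℝ × ℝ)) : Prop :=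
  ∀ u : ℝ, (u, 0) ∈ U → X.Et (u, 0) = 1 ∧ X.Gt (u, 0) = 1 ∧ X.Ft (u, 0) = 0

/-- Gaussian curvature on `{v ≠ 0}`. -/
def Kdef (X : FrontalData) (p : ℝ × ℝ) : ℝ :=
  (X.Lt p * X.Nt p - p.2 * (X.Mt p) ^ 2) / (p.2 * X.EGF p)

/-- Mean curvature on `{v ≠ 0}`. -/
def Hdef (X : FrontalData) (p : ℝ × ℝ) : ℝ :=
  (X.Et p * X.Nt p - 2 * p.2 * X.Ft p * X.Mt p + p.2 * X.Gt p * X.Lt p) / (2 * p.2 * X.EGF p)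

/-- Principal curvatures on `{v ≠ 0}`. -/
def kap1 (X : FrontalData) (p : ℝ × ℝ) : ℝ := X.Hdef p + Real.sqrt ((X.Hdef p) ^ 2 - X.Kdef p)
def kap2 (X : FrontalData) (p : ℝ × ℝ) : ℝ := X.Hdef p - Real.sqrt ((X.Hdef p) ^ 2 - X.Kdef p)

/-- Limiting normal curvature along the singular curve. -/
def kapNu (X : FrontalData) (u : ℝ) : ℝ := X.Lt (u, 0)
/-- Cuspidal torsion along the singular curve. -/
def kapT (X : FrontalData) (u : ℝ) : ℝ := X.Mt (u, 0)
/-- Bias along the singular curve. -/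
def rb (X : FrontalData) (u : ℝ) : ℝ := 3 * Dv X.Nt (u, 0)
/-- Secondary cuspidal curvature along the singular curve. -/
def rc (X : FrontalData) (u : ℝ) : ℝ :=
  12 * (Dv (Dv X.Nt) (u, 0) - 4 * Dv X.Ft (u, 0) * X.Mt (u, 0) -
    2 * Dv X.Gt (u, 0) * Dv X.Nt (u, 0))

end FrontalData

/-- Directional derivative of a map along the vector field `a ∂_u + ∂_v`. -/
def etaD (a : ℝ × ℝ → ℝ) (g : ℝ × ℝ → V3) : ℝ × ℝ → V3 :=
  fun p => a p • Du g p + Dv g p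

/-- Integration over `[0, 1]` in one variable preserves `C^n` dependence on the other variables. -/
theorem contDiff_nat_integral_zero_one {H : Type} [NormedAddCommGroup H] [NormedSpace ℝ H]
    [FiniteDimensional ℝ H] (n : ℕ) : ∀ {E : Type} [NormedAddCommGroup E] [NormedSpace ℝ E]
    {F : H × ℝ → E}, ContDiff ℝ n F → ContDiff ℝ n fun x => ∫ t in (0 : ℝ)..1, F (x, t) := by
  induction n with
  | zero =>
    intro E _ _ F hF
    simp only [Nat.cast_zero, contDiff_zero] at hF ⊢
    exact intervalIntegral.continuous_parametric_intervalIntegral_of_continuous'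
      (f := fun x t => F (x, t)) hF 0 1
  | succ n ih =>
    intro E _ _ F hF
    let F' : H × ℝ → H →L[ℝ] E := fun q => (fderiv ℝ F q).comp (ContinuousLinearMap.inl ℝ H ℝ)
    have hF' : ContDiff ℝ n F' := by
      have h := hF.fderiv_right (m := n) (by norm_cast)
      exact h.clm_comp contDiff_const
    have hdiff : ∀ x t, HasFDerivAt (fun y => F (y, t)) (F' (x, t)) x := fun x t =>
      ((hF.differentiable (by norm_cast)) (x, t)).hasFDerivAt.comp x (hasFDerivAt_prodMk_left x t)
    have hsec : ∀ x, Continuous fun t => F (x, t) := fun x =>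
      hF.continuous.comp (by fun_prop)
    have hsec' : ∀ x, Continuous fun t => F' (x, t) := fun x =>
      hF'.continuous.comp (by fun_prop)
    have hint : ∀ x, HasFDerivAt (fun x => ∫ t in (0 : ℝ)..1, F (x, t))
        (∫ t in (0 : ℝ)..1, F' (x, t)) x := by
      intro x
      have : ProperSpace H := FiniteDimensional.proper ℝ H
      obtain ⟨C, hC⟩ := ((isCompact_closedBall x 1).prod
        (isCompact_Icc (a := (0 : ℝ)) (b := 1))).exists_bound_of_continuousOn
          hF'.continuous.continuousOn
      refine intervalIntegral.hasFDerivAt_integral_of_dominated_of_fderiv_le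
        (F := fun x t => F (x, t)) (F' := fun x t => F' (x, t)) (bound := fun _ => C)
        (Metric.closedBall_mem_nhds x one_pos) (.of_forall fun y => (hsec y).aestronglyMeasurable)
        ((hsec x).intervalIntegrable _ _) (hsec' x).aestronglyMeasurable
        (.of_forall fun t ht y hy => hC (y, t) ⟨hy, ?_⟩) (by simp)
        (.of_forall fun t _ y _ => hdiff y t)
      rw [uIoc_of_le zero_le_one] at ht
      exact Ioc_subset_Icc_self ht
    push_cast
    exact contDiff_succ_iff_hasFDerivAt.2 ⟨_, ih hF', by simpa using hint⟩

theorem contDiff_integral_zero_one {H E : Type} [NormedAddCommGroup H] [NormedSpace ℝ H]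
    [FiniteDimensional ℝ H] [NormedAddCommGroup E] [NormedSpace ℝ E] {F : H × ℝ → E}
    (hF : ContDiff ℝ ∞ F) : ContDiff ℝ ∞ fun x => ∫ t in (0 : ℝ)..1, F (x, t) :=
  contDiff_infty.2 fun n => contDiff_nat_integral_zero_one n (contDiff_infty.1 hF n)

theorem ContDiff.Du {E : Type*} [NormedAddCommGroup E] [NormedSpace ℝ E] {g : ℝ × ℝ → E}
    (hg : ContDiff ℝ ∞ g) : ContDiff ℝ ∞ (Du g) :=
  (hg.fderiv_right (m := ∞) (by simp)).clm_apply contDiff_const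

theorem ContDiff.Dv {E : Type*} [NormedAddCommGroup E] [NormedSpace ℝ E] {g : ℝ × ℝ → E}
    (hg : ContDiff ℝ ∞ g) : ContDiff ℝ ∞ (Dv g) :=
  (hg.fderiv_right (m := ∞) (by simp)).clm_apply contDiff_const

theorem contDiff_dot {a b : ℝ × ℝ → V3} (ha : ContDiff ℝ ∞ a) (hb : ContDiff ℝ ∞ b) :
    ContDiff ℝ ∞ fun p => dot (a p) (b p) := by
  rw [contDiff_pi] at ha hb
  simp only [dot, dotProduct]
  exact ContDiff.sum fun i _ => (ha i).mul (hb i)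

/-- Hadamard's lemma in the second variable. -/
theorem exists_contDiff_eq_add_smul {E : Type} [NormedAddCommGroup E] [NormedSpace ℝ E]
    [CompleteSpace E] {g : ℝ × ℝ → E} (hg : ContDiff ℝ ∞ g) :
    ∃ k : ℝ × ℝ → E, ContDiff ℝ ∞ k ∧ ∀ p, g p = g (p.1, 0) + p.2 • k p := by
  let s : (ℝ × ℝ) × ℝ → ℝ × ℝ := fun q => (q.1.1, q.2 * q.1.2)
  have hs : ContDiff ℝ ∞ s := by fun_prop
  refine ⟨fun p => ∫ t in (0 : ℝ)..1, Dv g (s (p, t)),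
    contDiff_integral_zero_one (hg.Dv.comp hs), fun p => ?_⟩
  have hd : ∀ t : ℝ, HasDerivAt (fun t : ℝ => g (s (p, t))) (p.2 • Dv g (s (p, t))) t := by
    intro t
    have h1 : HasDerivAt (fun t : ℝ => s (p, t)) (0, p.2) t := by
      simpa using (hasDerivAt_const t p.1).prodMk ((hasDerivAt_id t).mul_const p.2)
    have h2 := ((hg.differentiable (by simp)) (s (p, t))).hasFDerivAt.comp_hasDerivAt t h1
    have h3 : ((0, p.2) : ℝ × ℝ) = p.2 • (0, 1) := by simp
    rw [h3, map_smul] at h2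
    exact h2
  have hc : Continuous fun t : ℝ => p.2 • Dv g (s (p, t)) :=
    (hg.Dv.continuous.comp (hs.continuous.comp (by fun_prop))).const_smul _
  have h := intervalIntegral.integral_eq_sub_of_hasDerivAt (fun t _ => hd t)
    (hc.intervalIntegrable 0 1)
  rw [intervalIntegral.integral_smul] at h
  rw [h]
  simp [s]

theorem Dv_dot {a b : ℝ × ℝ → V3} (ha : Differentiable ℝ a) (hb : Differentiable ℝ b)
    (p : ℝ × ℝ) :
    Dv (fun q => dot (a q) (b q)) p = dot (Dv a p) (b p) + dot (a p) (Dv b p) := by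
  have h : HasFDerivAt (fun q => ∑ i, a q i * b q i) _ p := HasFDerivAt.fun_sum fun i _ =>
    (hasFDerivAt_pi'.1 (ha p).hasFDerivAt i).mul (hasFDerivAt_pi'.1 (hb p).hasFDerivAt i)
  have h' : fderiv ℝ (fun q => dot (a q) (b q)) p = _ := h.fderiv
  rw [Dv, h']
  simp [Dv, dot, dotProduct, ← Finset.sum_add_distrib, mul_comm, add_comm]

theorem Dv_eq_zero_of_eqOn_const {E : Type*} [NormedAddCommGroup E] [NormedSpace ℝ E]
    {g : ℝ × ℝ → E} {U : Set (ℝ × ℝ)} {c : E} (hU : IsOpen U) (hg : ∀ q ∈ U, g q = c)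
    {p : ℝ × ℝ} (hp : p ∈ U) : Dv g p = 0 := by
  have h : g =ᶠ[nhds p] fun _ => c := Filter.eventually_of_mem (hU.mem_nhds hp) hg
  simp [Dv, h.fderiv_eq]

theorem Dv_Du_comm {E : Type*} [NormedAddCommGroup E] [NormedSpace ℝ E] {g : ℝ × ℝ → E}
    (hg : ContDiff ℝ ∞ g) (p : ℝ × ℝ) : Dv (Du g) p = Du (Dv g) p := by
  have hd : DifferentiableAt ℝ (fderiv ℝ g) p :=
    (hg.fderiv_right (m := ∞) (by simp)).differentiable (by simp) p
  have hsymm : IsSymmSndFDerivAt ℝ g p := hg.contDiffAt.isSymmSndFDerivAt <| by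
    rw [minSmoothness_of_isRCLikeNormedField]
    exact WithTop.coe_le_coe.2 le_top
  have key : ∀ x y : ℝ × ℝ,
      fderiv ℝ (fun q => fderiv ℝ g q x) p y = fderiv ℝ (fderiv ℝ g) p y x := by
    intro x y
    rw [fderiv_clm_apply hd (differentiableAt_const x)]
    simp
  exact (key _ _).trans ((hsymm _ _).trans (key _ _).symm)

theorem eq_zero_of_det3_ne_zero {a b c x : V3} (h : det3 a b c ≠ 0) (ha : dot a x = 0)
    (hb : dot b x = 0) (hc : dot c x = 0) : x = 0 := by
  refine Matrix.eq_zero_of_mulVec_eq_zero h ?_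
  ext i
  fin_cases i
  exacts [ha, hb, hc]

/-- At pure-frontal singular points the unit normal is stationary in the null direction. -/
theorem FrontalData.IsAdapted.Dv_nu_eq_zero {X : FrontalData} {U : Set (ℝ × ℝ)}
    (hA : X.IsAdapted U) {u : ℝ} (hu : (u, 0) ∈ U) (hN : X.Nt (u, 0) = 0) :
    Dv X.nu (u, 0) = 0 := by
  obtain ⟨hU, -, hf, hnu, hh, hunit, hfu, -, hfv, hdet, -⟩ := hA
  have dnu := hnu.differentiable (by simp)
  refine eq_zero_of_det3_ne_zero (hdet _ hu) ?_ (neg_eq_zero.1 hN) ?_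
  · have hmixed : Dv (Du X.f) (u, 0) = 0 := by
      rw [Dv_Du_comm hf]
      have h : Dv X.f =ᶠ[nhds (u, 0)] fun q => q.2 • X.h q :=
        Filter.eventually_of_mem (hU.mem_nhds hu) hfv
      have hd := hh.differentiable (by simp) (u, 0)
      rw [Du, h.fderiv_eq, fderiv_fun_smul differentiableAt_snd hd, fderiv_snd]
      simp
    have h := Dv_eq_zero_of_eqOn_const hU hfu hu
    rw [Dv_dot (hf.Du.differentiable (by simp)) dnu, hmixed] at h
    simpa [dot] using h
  · have h := Dv_eq_zero_of_eqOn_const hU hunit hu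
    rw [Dv_dot dnu dnu] at h
    simp only [dot, dotProduct_comm (Dv X.nu (u, 0))] at h ⊢
    linarith

/-- near a singular curve of pure-frontal singular points one can write
`ν_v = v·φ` and `Ñ = v·Ñ₁`; the Gaussian and mean curvature then equal
`K = (L̃Ñ₁ − M̃²)/(ẼG̃ − F̃²)` and `H = (ẼÑ₁ − 2F̃M̃ + G̃L̃)/(2(ẼG̃ − F̃²))` on `{v ≠ 0}`,
and these expressions are smooth on all of `U`. -/
theorem stmt5 (X : FrontalData) (U : Set (ℝ × ℝ)) (hA : X.IsAdapted U)
    (hstar : ∀ p ∈ U, ∀ t : ℝ, t ∈ Set.Icc (0 : ℝ) 1 → ((p.1, t * p.2) : ℝ × ℝ) ∈ U)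
    (hpure : ∀ u : ℝ, (u, 0) ∈ U → X.Nt (u, 0) = 0) :
    ∃ φ : ℝ × ℝ → V3, ∃ N1 : ℝ × ℝ → ℝ,
      ContDiffOn ℝ ∞ φ U ∧ ContDiffOn ℝ ∞ N1 U ∧
      (∀ p ∈ U, Dv X.nu p = p.2 • φ p ∧ X.Nt p = p.2 * N1 p) ∧
      (∀ p ∈ U, p.2 ≠ 0 →
        X.Kdef p = (X.Lt p * N1 p - (X.Mt p) ^ 2) / X.EGF p ∧
        X.Hdef p = (X.Et p * N1 p - 2 * X.Ft p * X.Mt p + X.Gt p * X.Lt p) / (2 * X.EGF p)) ∧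
      ContDiffOn ℝ ∞ (fun p => (X.Lt p * N1 p - (X.Mt p) ^ 2) / X.EGF p) U ∧
      ContDiffOn ℝ ∞
        (fun p => (X.Et p * N1 p - 2 * X.Ft p * X.Mt p + X.Gt p * X.Lt p) / (2 * X.EGF p)) U := by
  obtain ⟨φ, hφ, hφ_eq⟩ := exists_contDiff_eq_add_smul (g := Dv X.nu) hA.2.2.2.1.Dv
  have hnu_v : ∀ p ∈ U, Dv X.nu p = p.2 • φ p := by
    intro p hp
    have hu : (p.1, 0) ∈ U := by simpa using hstar p hp 0 (by simp)
    rw [hφ_eq p, hA.Dv_nu_eq_zero hu (hpure _ hu), zero_add]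
  obtain ⟨-, -, hf, hnu, hh, -, -, -, -, -, hEGF⟩ := hA
  have hNt : ∀ p ∈ U, X.Nt p = p.2 * -dot (X.h p) (φ p) := by
    intro p hp
    simp [FrontalData.Nt, hnu_v p hp, dot]
  have hN1 : ContDiff ℝ ∞ fun p => -dot (X.h p) (φ p) := (contDiff_dot hh hφ).neg
  have hE : ContDiff ℝ ∞ X.Et := contDiff_dot hf.Du hf.Du
  have hF : ContDiff ℝ ∞ X.Ft := contDiff_dot hf.Du hh
  have hG : ContDiff ℝ ∞ X.Gt := contDiff_dot hh hh
  have hL : ContDiff ℝ ∞ X.Lt := (contDiff_dot hf.Du hnu.Du).neg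
  have hM : ContDiff ℝ ∞ X.Mt := (contDiff_dot hh hnu.Du).neg
  have hD : ContDiff ℝ ∞ X.EGF := (hE.mul hG).sub (hF.pow 2)
  refine ⟨φ, fun p => -dot (X.h p) (φ p), hφ.contDiffOn, hN1.contDiffOn,
    fun p hp => ⟨hnu_v p hp, hNt p hp⟩, fun p hp hv => ?_, ?_, ?_⟩
  · have := (hEGF p hp).ne'
    constructor
    · rw [FrontalData.Kdef, hNt p hp]
      field_simp
    · rw [FrontalData.Hdef, hNt p hp]
      field_simp
  · exact ((hL.mul hN1).sub (hM.pow 2)).contDiffOn.div hD.contDiffOn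
      fun p hp => (hEGF p hp).ne'
  · exact (((hE.mul hN1).sub ((contDiff_const.mul hF).mul hM)).add (hG.mul hL)).contDiffOn.div
      (contDiff_const.mul hD).contDiffOn fun p hp => mul_ne_zero two_ne_zero (hEGF p hp).ne'
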